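/- Let (E,d) be a complete metric space and p, q, r ≥ 1 with 1/p = 1/q + 1/r. Let f : ℝ × E → E be measurable with f(·,x) locally p-integrable for each x, and suppose there exists a nonnegative S^r-bounded function L : ℝ → ℝ such that d(f(t,u), f(t,v)) ≤ L(t)·d(u,v) for all t ∈ ℝ and u, v ∈ E. Then f(·,x) is S^p-almost periodic for every x ∈ E if and only if f is S^p-almost periodic uniformly on compact subsets of E, i.e. for every compact K ⊆ E and every ε > 0 the set {τ ∈ ℝ : sup_{x∈K} D_{S^p}(f(·+τ,x), f(·,x)) ≤ ε} is relatively dense. -/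

import Mathlib

open MeasureTheory Filter Topology

/-- A set `A ⊆ ℝ` is relatively dense. -/
def RelDense (A : Set ℝ) : Prop := ∃ l > 0, ∀ a : ℝ, ∃ τ ∈ A, τ ∈ Set.Icc a (a + l)

/-- `f` is Stepanov almost periodic of order `p`. -/
def SpAP {E : Type*} [PseudoMetricSpace E] (p : ℝ) (f : ℝ → E) : Prop :=
  ∀ ε > 0, RelDense {τ : ℝ | ∀ x : ℝ,
    (∫ t in x..(x + 1), dist (f (t + τ)) (f t) ^ p) ^ (1 / p) ≤ ε}

/-- Local `p`-integrability of a metric-space valued function. -/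
def LocInt {E : Type*} [PseudoMetricSpace E] (p : ℝ) (f : ℝ → E) : Prop :=
  ∀ (x₀ : E) (a b : ℝ), IntervalIntegrable (fun t => dist (f t) x₀ ^ p) volume a b

/-- A standard Borel space in which every set is measurable is countable. -/
theorem countable_of_forall_measurableSet {X : Type*} [MeasurableSpace X] [StandardBorelSpace X]
    (h : ∀ s : Set X, MeasurableSet s) : Countable X := by
  by_contra hX
  let e := PolishSpace.measurableEquivNatBoolOfNotCountable hX
  have hall : ∀ s : Set (ℕ → Bool), MeasurableSet s := fun s => by
    simpa using e.symm.measurable (h (e ⁻¹' s))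
  have hle := MeasurableSpace.cardinal_measurableSet_le_continuum
    (s := MeasurableSpace.countableGeneratingSet (ℕ → Bool))
    ((MeasurableSpace.countable_countableGeneratingSet.le_aleph0).trans
      Cardinal.aleph0_le_continuum)
  rw [MeasurableSpace.generateFrom_countableGeneratingSet] at hle
  have huniv : {t : Set (ℕ → Bool) | MeasurableSet t} = Set.univ := Set.eq_univ_of_forall hall
  rw [huniv, Cardinal.mk_univ, Cardinal.mk_set] at hle
  have hc : Cardinal.mk (ℕ → Bool) = Cardinal.continuum := by simp
  rw [hc] at hle
  exact absurd (Cardinal.cantor _) hle.not_gt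

theorem Metric.IsSeparated.isClosed {E : Type*} [MetricSpace E] {ε : ENNReal}
    (hε : 0 < ε) {N : Set E} (hN : Metric.IsSeparated ε N) : IsClosed N :=
  isClosed_of_spaced_out (edist_mem_uniformity hε) <| by
    intro x hx y hy hxy
    simpa using (hN hx hy hxy).le

theorem Metric.exists_maximal_isSeparated {E : Type*} [PseudoMetricSpace E] (ε : ENNReal)
    (s : Set E) : ∃ N, Maximal (fun N ↦ N ⊆ s ∧ Metric.IsSeparated ε N) N := by
  obtain ⟨N, hN⟩ := zorn_subset {N | N ⊆ s ∧ Metric.IsSeparated ε N} fun c hc hchain =>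
    ⟨⋃₀ c, ⟨Set.sUnion_subset fun t ht => (hc ht).1,
      (Set.pairwise_sUnion hchain.directedOn).2 fun t ht => (hc ht).2⟩,
      fun t ht => Set.subset_sUnion_of_mem ht⟩
  exact ⟨N, hN⟩

theorem Measurable.countable_of_isSeparated_subset_range {X E : Type*} [MeasurableSpace X]
    [StandardBorelSpace X] [MetricSpace E] [MeasurableSpace E] [OpensMeasurableSpace E]
    {f : X → E} (hf : Measurable f) {ε : ENNReal} (hε : 0 < ε) {N : Set E}
    (hNf : N ⊆ Set.range f) (hN : Metric.IsSeparated ε N) : N.Countable := by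
  classical
  have hmeas : ∀ S ⊆ N, MeasurableSet (f ⁻¹' S) := fun S hS =>
    hf ((hN.subset hS).isClosed hε).measurableSet
  rcases isEmpty_or_nonempty X with hX | hX
  · rw [Set.range_eq_empty, Set.subset_empty_iff] at hNf
    simp [hNf]
  have hs : ∀ d ∈ N, f (Function.invFun f d) = d := fun d hd => Function.invFun_eq (hNf hd)
  set s := Function.invFun f
  let h : X → X := fun x => if f x ∈ N then s (f x) else x
  have hh : Measurable h := by
    intro S hS
    have : h ⁻¹' S = f ⁻¹' {d ∈ N | s d ∈ S} ∪ ((f ⁻¹' N)ᶜ ∩ S) := by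
      ext x
      by_cases hx : f x ∈ N <;> simp [h, hx]
    rw [this]
    exact (hmeas _ (Set.sep_subset _ _)).union ((hmeas N subset_rfl).compl.inter hS)
  let T : Set X := f ⁻¹' N ∩ {x | h x = x}
  have hT : MeasurableSet T :=
    (hmeas N subset_rfl).inter (measurableSet_eq_fun hh measurable_id)
  have hTs : ∀ x ∈ T, s (f x) = x := fun x hx => by
    have := hx.2
    simpa [h, show f x ∈ N from hx.1] using this
  have := hT.standardBorel
  have hcount : Countable T := by
    refine countable_of_forall_measurableSet fun S => ?_
    have : S = Subtype.val ⁻¹' (f ⁻¹' (f '' (Subtype.val '' S))) := by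
      ext x
      refine ⟨fun hx => ⟨x, ⟨x, hx, rfl⟩, rfl⟩, ?_⟩
      rintro ⟨_, ⟨y, hy, rfl⟩, hyx⟩
      have : y = x := Subtype.ext (by rw [← hTs y y.2, ← hTs x x.2, hyx])
      exact this ▸ hy
    rw [this]
    refine measurable_subtype_coe (hmeas _ ?_)
    rintro _ ⟨_, ⟨y, -, rfl⟩, rfl⟩
    exact y.2.1
  refine ((Set.countable_coe_iff.1 hcount).image f).mono fun d hd => by
    refine ⟨s d, ⟨?_, ?_⟩, hs d hd⟩
    · simpa [hs d hd] using hd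
    · simp [h, hs d hd, hd]

/-- A measurable map from a standard Borel space to a metric space has separable range. -/
theorem Measurable.isSeparable_range {X E : Type*} [MeasurableSpace X]
    [StandardBorelSpace X] [MetricSpace E] [MeasurableSpace E] [OpensMeasurableSpace E]
    {f : X → E} (hf : Measurable f) : TopologicalSpace.IsSeparable (Set.range f) := by
  obtain ⟨t, -, ht, hft⟩ := EMetric.subset_countable_closure_of_almost_dense_set (Set.range f)
    fun ε hε => by
      obtain ⟨δ, hδ, hδε⟩ := ENNReal.lt_iff_exists_nnreal_btwn.1 hε
      obtain ⟨N, hN⟩ := Metric.exists_maximal_isSeparated (δ : ENNReal) (Set.range f)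
      refine ⟨N, hf.countable_of_isSeparated_subset_range hδ hN.1.1 hN.1.2, ?_⟩
      refine (Metric.isCover_iff_subset_iUnion_closedEBall.1
        (Metric.IsCover.of_maximal_isSeparated hN)).trans ?_
      exact Set.iUnion₂_mono fun x _ => Metric.closedEBall_subset_closedEBall hδε.le
  exact ⟨t, ht, hft⟩

theorem Measurable.stronglyMeasurable_of_standardBorel {X E : Type*} [MeasurableSpace X]
    [StandardBorelSpace X] [MetricSpace E] [m : MeasurableSpace E] [OpensMeasurableSpace E]
    {f : X → E} (hf : Measurable f) : StronglyMeasurable f := by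
  have hsep := hf.isSeparable_range
  have hf' := hf.mono le_rfl (OpensMeasurableSpace.borel_le (α := E))
  clear hf
  let _ : MeasurableSpace E := borel E
  have : BorelSpace E := ⟨rfl⟩
  exact stronglyMeasurable_iff_measurable_separable.2 ⟨hf', hsep⟩

/-- A pigeonhole principle producing common almost periods of finitely many total-boundedness
conditions. -/
theorem relDense_forall {ι : Type*} [Finite ι] {P Q : ι → ℝ → Prop}
    (hPQ : ∀ i a b, P i a → P i b → Q i (a - b))
    (hP : ∀ i, ∃ C : Set ℝ, C.Finite ∧ ∀ t, ∃ c ∈ C, P i (t - c)) :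
    RelDense {τ | ∀ i, Q i τ} := by
  choose C hC c hcC hcP using hP
  have hfin : (Set.range fun t i => c i t).Finite :=
    (Set.Finite.pi' hC).subset (by rintro _ ⟨t, rfl⟩ i; exact hcC i t)
  let rep : ℝ → ℝ := fun t => Function.invFun (fun t i => c i t) fun i => c i t
  have hrep : ∀ t i, c i (rep t) = c i t := fun t i =>
    congrFun (Function.invFun_eq (f := fun t i => c i t) ⟨t, rfl⟩) i
  obtain ⟨M, hM⟩ : ∃ M, ∀ t, |rep t| ≤ M := by
    have := (hfin.image (Function.invFun fun t i => c i t)).isBounded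
    obtain ⟨M, hM⟩ := isBounded_iff_forall_norm_le.1 this
    exact ⟨M, fun t => hM _ ⟨_, ⟨t, rfl⟩, rfl⟩⟩
  have hM0 : 0 ≤ M := (abs_nonneg _).trans (hM 0)
  refine ⟨2 * M + 1, by positivity, fun a => ⟨a + M - rep (a + M), fun i => ?_, ?_⟩⟩
  · have := hPQ i _ _ (hcP i (a + M)) (hcP i (rep (a + M)))
    rwa [hrep, sub_sub_sub_cancel_right] at this
  · have := abs_le.1 (hM (a + M))
    constructor <;> linarith

theorem eLpNorm_comp_add_right_restrict_Ioc {V : Type*} [NormedAddCommGroup V] {g : ℝ → V}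
    (hg : StronglyMeasurable g) (P : ENNReal) (a b c : ℝ) :
    eLpNorm (fun t => g (t + c)) P (volume.restrict (Set.Ioc a b)) =
      eLpNorm g P (volume.restrict (Set.Ioc (a + c) (b + c))) := by
  have h := (measurePreserving_add_right (volume : Measure ℝ) c).restrict_preimage
    (measurableSet_Ioc (a := a + c) (b := b + c))
  rw [Set.preimage_add_const_Ioc, add_sub_cancel_right, add_sub_cancel_right] at h
  exact eLpNorm_comp_measurePreserving hg.aestronglyMeasurable h

/-- Translation is continuous in the `L^P` norm on bounded intervals. -/
theorem exists_eLpNorm_translate_sub_le {V : Type*} [NormedAddCommGroup V] {F : ℝ → V}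
    {P : ENNReal} (hP1 : 1 ≤ P) (hP : P ≠ ⊤)
    (hF : ∀ a b, MemLp F P (volume.restrict (Set.Ioc a b))) (l : ℝ) {ε : ENNReal} (hε : 0 < ε) :
    ∃ δ > 0, ∀ h, |h| < δ →
      eLpNorm (fun t => F (t + h) - F t) P (volume.restrict (Set.Ioc 0 l)) ≤ ε := by
  have : Fact (1 ≤ P) := ⟨hP1⟩
  let G := (Set.Ioc (-1) (l + 1)).indicator F
  have hG : MemLp G P volume := (memLp_indicator_iff_restrict measurableSet_Ioc).2 (hF _ _)
  have hmp : ∀ h : ℝ, MeasurePreserving (fun t : ℝ => t + h) volume volume :=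
    measurePreserving_add_right volume
  let T : ℝ → Lp V P (volume : Measure ℝ) := fun h =>
    Lp.compMeasurePreserving (fun t => t + h) (hmp h) (hG.toLp G)
  let φ : C(ℝ, C(ℝ, ℝ)) :=
    (ContinuousMap.mk (fun a : ℝ × ℝ => a.2 + a.1) (by fun_prop)).curry
  have hT : Continuous T :=
    (continuous_const (y := hG.toLp G)).compMeasurePreservingLp φ.continuous hmp hP
  have hlim : Tendsto (fun h => edist (T h) (T 0)) (𝓝 0) (𝓝 0) := by
    simpa using (hT.tendsto 0).edist (tendsto_const_nhds (x := T 0))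
  obtain ⟨δ, hδ, hδε⟩ := Metric.eventually_nhds_iff.1 (hlim.eventually (Iic_mem_nhds hε))
  refine ⟨min δ 1, by positivity, fun h hh => ?_⟩
  have hTh := hδε (y := h) (by simpa using hh.trans_le (min_le_left _ _))
  have hT' : ∀ h, T h = (hG.comp_measurePreserving (hmp h)).toLp _ := fun h => rfl
  rw [hT', hT', Lp.edist_toLp_toLp] at hTh
  refine le_trans ?_ hTh
  refine (eLpNorm_congr_ae ?_).trans_le (eLpNorm_mono_measure _ Measure.restrict_le_self)
  filter_upwards [ae_restrict_mem measurableSet_Ioc] with t ht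
  have h1 := abs_lt.1 (hh.trans_le (min_le_right _ _))
  have hm : t + h ∈ Set.Ioc (-1) (l + 1) := ⟨by linarith [ht.1], by linarith [ht.2]⟩
  have hm' : t ∈ Set.Ioc (-1) (l + 1) := ⟨by linarith [ht.1], by linarith [ht.2]⟩
  simp [G, hm, hm']

theorem LocInt.memLp_dist {E : Type*} [MetricSpace E] {p : ℝ} (hp : 1 ≤ p) {f : ℝ → E}
    (hfm : StronglyMeasurable f) (hf : LocInt p f) (x₀ : E) (a b : ℝ) :
    MemLp (fun t => dist (f t) x₀) (ENNReal.ofReal p) (volume.restrict (Set.Ioc a b)) := by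
  have hp0 : 0 < p := by linarith
  refine (integrable_norm_rpow_iff
    (hfm.dist stronglyMeasurable_const).aestronglyMeasurable (by simpa) (by simp)).1 ?_
  simpa [ENNReal.toReal_ofReal hp0.le, IntegrableOn] using (hf x₀ a b).1

theorem LocInt.exists_eLpNorm_dist_translate_le {E : Type*} [MetricSpace E] {p : ℝ}
    (hp : 1 ≤ p) {f : ℝ → E} (hfm : StronglyMeasurable f) (hf : LocInt p f) (l : ℝ)
    {ε : ENNReal} (hε : 0 < ε) :
    ∃ δ > 0, ∀ h, |h| < δ → eLpNorm (fun t => dist (f (t + h)) (f t)) (ENNReal.ofReal p)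
      (volume.restrict (Set.Ioc 0 l)) ≤ ε := by
  have hsep := hfm.isSeparable_range
  have := hsep.secondCountableTopology
  borelize E
  have hr : StronglyMeasurable (Set.rangeFactorization f) :=
    hfm.measurable.subtype_mk.stronglyMeasurable
  let κ := kuratowskiEmbedding (Set.range f)
  have hκ : Isometry κ := kuratowskiEmbedding.isometry _
  let F := fun t => κ (Set.rangeFactorization f t)
  have hFm : StronglyMeasurable F := hκ.continuous.comp_stronglyMeasurable hr
  have hF : ∀ s t, ‖F s - F t‖ = dist (f s) (f t) := fun s t => by
    rw [← dist_eq_norm, hκ.dist_eq]; rfl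
  have hFL : ∀ a b, MemLp F (ENNReal.ofReal p) (volume.restrict (Set.Ioc a b)) := fun a b => by
    have h0 : MemLp (fun t => F t - F 0) (ENNReal.ofReal p) (volume.restrict (Set.Ioc a b)) :=
      (hf.memLp_dist hp hfm (f 0) a b).of_le
        (hFm.sub stronglyMeasurable_const).aestronglyMeasurable
        (Eventually.of_forall fun t => by rw [hF]; exact le_abs_self _)
    simpa [Pi.add_def] using h0.add (memLp_const (F 0))
  obtain ⟨δ, hδ, h⟩ := exists_eLpNorm_translate_sub_le
    (by simpa using ENNReal.ofReal_le_ofReal hp) ENNReal.ofReal_ne_top hFL l hε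
  refine ⟨δ, hδ, fun s hs => le_trans (eLpNorm_mono fun t => ?_) (h s hs)⟩
  rw [hF, Real.norm_of_nonneg dist_nonneg]

/-- `τ` translates `f` by a Stepanov distance of at most `ε`. -/
def StepanovAlmostPeriod {E : Type*} [PseudoMetricSpace E] (p : ℝ) (f : ℝ → E) (ε : ENNReal)
    (τ : ℝ) : Prop :=
  ∀ u, eLpNorm (fun t => dist (f (t + τ)) (f t)) (ENNReal.ofReal p)
    (volume.restrict (Set.Ioc u (u + 1))) ≤ ε

theorem MeasureTheory.StronglyMeasurable.dist_translate {E : Type*} [PseudoMetricSpace E]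
    {f : ℝ → E} (hf : StronglyMeasurable f) (σ τ : ℝ) :
    StronglyMeasurable fun t => dist (f (t + σ)) (f (t + τ)) :=
  (hf.comp_measurable (measurable_add_const σ)).dist (hf.comp_measurable (measurable_add_const τ))

theorem eLpNorm_dist_triangle {α E : Type*} [MeasurableSpace α] {μ : Measure α}
    [PseudoMetricSpace E] {f g h : α → E} (hf : StronglyMeasurable f) (hg : StronglyMeasurable g)
    (hh : StronglyMeasurable h) {P : ENNReal} (hP : 1 ≤ P) :
    eLpNorm (fun t => dist (f t) (h t)) P μ ≤
      eLpNorm (fun t => dist (f t) (g t)) P μ + eLpNorm (fun t => dist (g t) (h t)) P μ := by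
  refine le_trans (eLpNorm_mono_real fun t => ?_) (eLpNorm_add_le
    (hf.dist hg).aestronglyMeasurable (hg.dist hh).aestronglyMeasurable hP)
  rw [Real.norm_of_nonneg dist_nonneg]
  exact dist_triangle _ _ _

namespace StepanovAlmostPeriod

variable {E : Type*} [MetricSpace E] {p : ℝ} {f : ℝ → E} {ε δ : ENNReal} {σ τ : ℝ}

theorem neg (hf : StronglyMeasurable f) (h : StepanovAlmostPeriod p f ε τ) :
    StepanovAlmostPeriod p f ε (-τ) := fun u => by
  have := eLpNorm_comp_add_right_restrict_Ioc (hf.dist_translate τ 0) (ENNReal.ofReal p)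
    u (u + 1) (-τ)
  simp only [neg_add_cancel_right, add_zero, dist_comm (f _) (f (_ + -τ)),
    add_right_comm u 1 (-τ)] at this
  rw [this]
  exact h _

theorem add (hp : 1 ≤ p) (hf : StronglyMeasurable f) (hσ : StepanovAlmostPeriod p f ε σ)
    (hτ : StepanovAlmostPeriod p f δ τ) : StepanovAlmostPeriod p f (ε + δ) (σ + τ) := fun u => by
  have hm : ∀ c, StronglyMeasurable fun t => f (t + c) := fun c =>
    hf.comp_measurable (measurable_add_const c)
  refine (eLpNorm_dist_triangle (hm _) (hm τ) hf
    (by simpa using ENNReal.ofReal_le_ofReal hp)).trans (add_le_add ?_ (hτ u))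
  have := eLpNorm_comp_add_right_restrict_Ioc (hf.dist_translate σ 0) (ENNReal.ofReal p)
    u (u + 1) τ
  simp only [add_zero, add_assoc, add_comm τ σ, add_comm (1 : ℝ) τ] at this
  rw [this, ← add_assoc]
  exact hσ _

/-- Stepanov almost periodic functions are uniformly continuous in the Stepanov distance. -/
theorem exists_forall_abs_lt (hp : 1 ≤ p) (hf : StronglyMeasurable f) (hfl : LocInt p f)
    (hap : ∀ ε > 0, RelDense {τ | StepanovAlmostPeriod p f ε τ}) (hε : 0 < ε) :
    ∃ δ > 0, ∀ h, |h| < δ → StepanovAlmostPeriod p f ε h := by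
  have hε3 : 0 < ε / 3 := ENNReal.div_pos hε.ne' (by simp)
  have hP : 1 ≤ ENNReal.ofReal p := by simpa using ENNReal.ofReal_le_ofReal hp
  have hm : ∀ c, StronglyMeasurable fun t => f (t + c) := fun c =>
    hf.comp_measurable (measurable_add_const c)
  obtain ⟨l, -, hl⟩ := hap _ hε3
  obtain ⟨δ, hδ, hδε⟩ := hfl.exists_eLpNorm_dist_translate_le hp hf (l + 1) hε3
  refine ⟨δ, hδ, fun h hh u => ?_⟩
  obtain ⟨τ, hτ, hτu⟩ := hl (-u)
  rw [← ENNReal.add_thirds ε]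
  refine (eLpNorm_dist_triangle (hm h) (hm τ) hf hP).trans (add_le_add ?_ (hτ u))
  refine (eLpNorm_dist_triangle (hm h) (hm (h + τ)) (hm τ) hP).trans (add_le_add ?_ ?_)
  · have := eLpNorm_comp_add_right_restrict_Ioc (hf.dist_translate 0 τ) (ENNReal.ofReal p)
      u (u + 1) h
    simp only [add_zero, add_assoc, add_comm (1 : ℝ) h] at this
    rw [this, ← add_assoc]
    simpa only [dist_comm] using hτ (u + h)
  · have := eLpNorm_comp_add_right_restrict_Ioc (hf.dist_translate h 0) (ENNReal.ofReal p)
      u (u + 1) τ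
    simp only [add_zero, add_assoc, add_comm τ h] at this
    rw [this]
    refine (eLpNorm_mono_measure _ (Measure.restrict_mono ?_ le_rfl)).trans (hδε h hh)
    exact Set.Ioc_subset_Ioc (by linarith [hτu.1]) (by linarith [hτu.2])

theorem exists_finite_cover (hp : 1 ≤ p) (hf : StronglyMeasurable f) (hfl : LocInt p f)
    (hap : ∀ ε > 0, RelDense {τ | StepanovAlmostPeriod p f ε τ}) (hε : 0 < ε) :
    ∃ C : Set ℝ, C.Finite ∧ ∀ t, ∃ c ∈ C, StepanovAlmostPeriod p f ε (t - c) := by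
  have hε2 : 0 < ε / 2 := ENNReal.half_pos hε.ne'
  obtain ⟨l, -, hl⟩ := hap _ hε2
  obtain ⟨δ, hδ, hδε⟩ := exists_forall_abs_lt hp hf hfl hap hε2
  obtain ⟨C, -, hC, hcover⟩ := finite_cover_balls_of_compact
    (isCompact_Icc (a := (0 : ℝ)) (b := l)) hδ
  refine ⟨C, hC, fun t => ?_⟩
  obtain ⟨τ, hτ, hτt⟩ := hl (t - l)
  obtain ⟨c, hc, hct⟩ := Set.mem_iUnion₂.1
    (hcover (show t - τ ∈ Set.Icc 0 l from ⟨by linarith [hτt.2], by linarith [hτt.1]⟩))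
  refine ⟨c, hc, ?_⟩
  have := add hp hf hτ (hδε (t - τ - c) hct)
  rwa [ENNReal.add_halves, show τ + (t - τ - c) = t - c by ring] at this

/-- Finitely many Stepanov almost periodic functions have relatively dense common almost periods. -/
theorem relDense_forall {ι : Type*} [Finite ι] {f : ι → ℝ → E} (hp : 1 ≤ p)
    (hf : ∀ i, StronglyMeasurable (f i)) (hfl : ∀ i, LocInt p (f i))
    (hap : ∀ i, ∀ ε > 0, RelDense {τ | StepanovAlmostPeriod p (f i) ε τ}) (hε : 0 < ε) :
    RelDense {τ | ∀ i, StepanovAlmostPeriod p (f i) ε τ} :=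
  _root_.relDense_forall (P := fun i => StepanovAlmostPeriod p (f i) (ε / 2))
    (fun i a b ha hb => by
      simpa [ENNReal.add_halves, sub_eq_add_neg] using add hp (hf i) ha (neg (hf i) hb))
    fun i => exists_finite_cover hp (hf i) (hfl i) (hap i) (ENNReal.half_pos hε.ne')

end StepanovAlmostPeriod

theorem rpow_integral_le_iff_eLpNorm_le {p : ℝ} (hp : 1 ≤ p) {g : ℝ → ℝ} (hg : ∀ t, 0 ≤ g t)
    {u : ℝ} (hgL : MemLp g (ENNReal.ofReal p) (volume.restrict (Set.Ioc u (u + 1)))) {ε : ℝ}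
    (hε : 0 ≤ ε) :
    (∫ t in u..(u + 1), g t ^ p) ^ (1 / p) ≤ ε ↔
      eLpNorm g (ENNReal.ofReal p) (volume.restrict (Set.Ioc u (u + 1))) ≤ ENNReal.ofReal ε := by
  have hp0 : 0 < p := by linarith
  rw [hgL.eLpNorm_eq_integral_rpow_norm (by simpa) (by simp), ENNReal.toReal_ofReal hp0.le,
    ENNReal.ofReal_le_ofReal_iff hε, intervalIntegral.integral_of_le (by linarith), one_div]
  simp_rw [Real.norm_of_nonneg (hg _)]

theorem LocInt.memLp_dist_translate {E : Type*} [MetricSpace E] {p : ℝ} (hp : 1 ≤ p) {f : ℝ → E}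
    (hfm : StronglyMeasurable f) (hf : LocInt p f) (τ a b : ℝ) :
    MemLp (fun t => dist (f (t + τ)) (f t)) (ENNReal.ofReal p)
      (volume.restrict (Set.Ioc a b)) := by
  have h0 := hf.memLp_dist hp hfm (f 0)
  have hτ : MemLp (fun t => dist (f (t + τ)) (f 0)) (ENNReal.ofReal p)
      (volume.restrict (Set.Ioc a b)) := by
    refine ⟨((hfm.comp_measurable (measurable_add_const τ)).dist
      stronglyMeasurable_const).aestronglyMeasurable, ?_⟩
    rw [eLpNorm_comp_add_right_restrict_Ioc (hfm.dist stronglyMeasurable_const)]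
    exact (h0 _ _).2
  refine (hτ.add (h0 a b)).of_le
    (by simpa using (hfm.dist_translate τ 0).aestronglyMeasurable)
    (Eventually.of_forall fun t => ?_)
  rw [Real.norm_of_nonneg dist_nonneg,
    Real.norm_of_nonneg (by simp only [Pi.add_apply]; positivity)]
  exact dist_triangle_right _ _ _

theorem stepanovAlmostPeriod_iff {E : Type*} [MetricSpace E] {p : ℝ} (hp : 1 ≤ p) {f : ℝ → E}
    (hfm : StronglyMeasurable f) (hf : LocInt p f) {ε : ℝ} (hε : 0 ≤ ε) (τ : ℝ) :
    StepanovAlmostPeriod p f (ENNReal.ofReal ε) τ ↔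
      ∀ u, (∫ t in u..(u + 1), dist (f (t + τ)) (f t) ^ p) ^ (1 / p) ≤ ε :=
  forall_congr' fun u => (rpow_integral_le_iff_eLpNorm_le hp (fun _ => dist_nonneg)
    (hf.memLp_dist_translate hp hfm τ u (u + 1)) hε).symm

theorem RelDense.mono {A B : Set ℝ} (hA : RelDense A) (h : A ⊆ B) : RelDense B := by
  obtain ⟨l, hl, hlA⟩ := hA
  refine ⟨l, hl, fun a => ?_⟩
  obtain ⟨τ, hτ, hτa⟩ := hlA a
  exact ⟨τ, h hτ, hτa⟩

theorem SpAP.relDense_stepanovAlmostPeriod {E : Type*} [MetricSpace E] {p : ℝ} (hp : 1 ≤ p)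
    {f : ℝ → E} (hfm : StronglyMeasurable f) (hfl : LocInt p f) (hf : SpAP p f) {ε : ENNReal}
    (hε : 0 < ε) : RelDense {τ | StepanovAlmostPeriod p f ε τ} := by
  obtain ⟨δ, hδ, hδε⟩ := ENNReal.lt_iff_exists_nnreal_btwn.1 hε
  refine (hf δ (by simpa using hδ)).mono fun τ hτ u => ?_
  have := (stepanovAlmostPeriod_iff hp hfm hfl δ.coe_nonneg τ).2 hτ u
  rw [ENNReal.ofReal_coe_nnreal] at this
  exact this.trans hδε.le

theorem exists_eLpNorm_le_of_bddAbove {p r : ℝ} (hp : 1 ≤ p) (hpr : p ≤ r) {L : ℝ → ℝ}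
    (hL0 : ∀ t, 0 ≤ L t) (hLm : Measurable L)
    (hLint : ∀ a b : ℝ, IntervalIntegrable (fun t => L t ^ r) volume a b)
    (hLbdd : BddAbove (Set.range fun x : ℝ => (∫ t in x..(x + 1), L t ^ r) ^ (1 / r))) :
    ∃ M : ℝ, 0 < M ∧ ∀ u, eLpNorm L (ENNReal.ofReal p) (volume.restrict (Set.Ioc u (u + 1))) ≤
      ENNReal.ofReal M := by
  have hr0 : 0 < r := by linarith
  obtain ⟨M, hM⟩ := hLbdd
  refine ⟨max M 1, by positivity, fun u => ?_⟩
  have : IsProbabilityMeasure (volume.restrict (Set.Ioc u (u + 1))) := ⟨by simp⟩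
  refine (eLpNorm_le_eLpNorm_of_exponent_le (ENNReal.ofReal_le_ofReal hpr)
    hLm.aestronglyMeasurable).trans ?_
  refine (rpow_integral_le_iff_eLpNorm_le (hp.trans hpr) hL0 ?_ (by positivity)).1
    ((hM ⟨u, rfl⟩).trans (le_max_left _ _))
  refine (integrable_norm_rpow_iff hLm.aestronglyMeasurable (by simpa) (by simp)).1 ?_
  simpa [ENNReal.toReal_ofReal hr0.le, IntegrableOn, abs_of_nonneg (hL0 _)]
    using (hLint u (u + 1)).1

theorem StepanovAlmostPeriod.of_dist_le {E : Type*} [MetricSpace E] {p : ℝ} (hp : 1 ≤ p)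
    {f g : ℝ → E} (hf : StronglyMeasurable f) (hg : StronglyMeasurable g) {η ε : ENNReal}
    (hfg : ∀ u, eLpNorm (fun t => dist (f t) (g t)) (ENNReal.ofReal p)
      (volume.restrict (Set.Ioc u (u + 1))) ≤ η) {τ : ℝ} (h : StepanovAlmostPeriod p g ε τ) :
    StepanovAlmostPeriod p f (η + ε + η) τ := fun u => by
  have hP : 1 ≤ ENNReal.ofReal p := by simpa using ENNReal.ofReal_le_ofReal hp
  have hfτ := hf.comp_measurable (measurable_add_const τ)
  have hgτ := hg.comp_measurable (measurable_add_const τ)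
  refine (eLpNorm_dist_triangle hfτ hg hf hP).trans (add_le_add
    ((eLpNorm_dist_triangle hfτ hgτ hg hP).trans (add_le_add ?_ (h u))) ?_)
  · have := eLpNorm_comp_add_right_restrict_Ioc (hf.dist hg) (ENNReal.ofReal p) u (u + 1) τ
    rw [add_right_comm] at this
    exact this.trans_le (hfg _)
  · simpa only [dist_comm] using hfg u

/-- under the Lipschitz condition (Lip) with an `S^r`-bounded function `L`
(where `1/p = 1/q + 1/r`), the parametric function `f` is `S^p`-almost periodic in each
variable `x` iff it is `S^p`-almost periodic uniformly with respect to `x` in compact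
subsets of `E`. -/
theorem stmt4 {E : Type*} [MetricSpace E] [CompleteSpace E]
    [MeasurableSpace E] [OpensMeasurableSpace E]
    (p q r : ℝ) (hp : 1 ≤ p) (hq : 1 ≤ q) (hr : 1 ≤ r) (hpqr : 1 / p = 1 / q + 1 / r)
    (f : ℝ → E → E)
    (hfm : ∀ x, Measurable fun t => f t x)
    (hfl : ∀ x, LocInt p fun t => f t x)
    (L : ℝ → ℝ) (hL0 : ∀ t, 0 ≤ L t) (hLm : Measurable L)
    (hLint : ∀ a b : ℝ, IntervalIntegrable (fun t => L t ^ r) volume a b)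
    (hLbdd : BddAbove (Set.range fun x : ℝ => (∫ t in x..(x + 1), L t ^ r) ^ (1 / r)))
    (hlip : ∀ (t : ℝ) (x y : E), dist (f t x) (f t y) ≤ L t * dist x y) :
    (∀ x : E, SpAP p fun t => f t x) ↔
      (∀ K : Set E, IsCompact K → ∀ ε > 0, RelDense {τ : ℝ | ∀ x ∈ K, ∀ u : ℝ,
          (∫ t in u..(u + 1), dist (f (t + τ) x) (f t x) ^ p) ^ (1 / p) ≤ ε}) := by
  have hpr : p ≤ r := by
    have hq0 : 0 ≤ 1 / q := by positivity
    exact (one_div_le_one_div (by linarith) (by linarith)).1 (by linarith)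
  have hsm : ∀ x, StronglyMeasurable fun t => f t x := fun x =>
    (hfm x).stronglyMeasurable_of_standardBorel
  constructor
  · intro hap K hK ε hε
    obtain ⟨M, hM, hLM⟩ := exists_eLpNorm_le_of_bddAbove hp hpr hL0 hLm hLint hLbdd
    let η := ε / 3 / M
    obtain ⟨F, -, hF, hKF⟩ := finite_cover_balls_of_compact hK
      (show 0 < η by positivity)
    have := hF.to_subtype
    refine (StepanovAlmostPeriod.relDense_forall (f := fun (y : F) t => f t y) hp
      (fun y => hsm y) (fun y => hfl y)
      (fun y δ hδ => (hap y).relDense_stepanovAlmostPeriod hp (hsm y) (hfl y) hδ)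
      (show 0 < ENNReal.ofReal (ε / 3) by simpa using hε)).mono fun τ hτ x hx => ?_
    obtain ⟨y, hy, hxy⟩ := Set.mem_iUnion₂.1 (hKF hx)
    refine (stepanovAlmostPeriod_iff hp (hsm x) (hfl x) hε.le τ).1 ?_
    have hdist : ∀ u, eLpNorm (fun t => dist (f t x) (f t y)) (ENNReal.ofReal p)
        (volume.restrict (Set.Ioc u (u + 1))) ≤ ENNReal.ofReal (ε / 3) := fun u => by
      refine (eLpNorm_mono_real (g := η • L) fun t => ?_).trans ?_
      · rw [Real.norm_of_nonneg dist_nonneg, Pi.smul_apply, smul_eq_mul, mul_comm]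
        exact (hlip t x y).trans (mul_le_mul_of_nonneg_left hxy.le (hL0 t))
      · rw [eLpNorm_const_smul, Real.enorm_eq_ofReal (show 0 ≤ η by positivity)]
        refine (mul_le_mul_right (hLM u) _).trans_eq ?_
        rw [← ENNReal.ofReal_mul (show 0 ≤ η by positivity), div_mul_cancel₀ _ hM.ne']
    have h := StepanovAlmostPeriod.of_dist_le hp (hsm x) (hsm y) hdist (hτ ⟨y, hy⟩)
    rwa [← ENNReal.ofReal_add (by positivity) (by positivity),
      ← ENNReal.ofReal_add (by positivity) (by positivity), add_thirds] at h
  · intro h x ε hε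
    exact (h {x} isCompact_singleton ε hε).mono fun τ hτ => hτ x rfl
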